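/- With the above setup, if in addition γ² > (K+1)²/(K−1), then the average squared poisoning score of the bad points is strictly larger than the average squared poisoning score of the clean points: (1/n_p)·∑_{x ∈ S_bad} q(x)² > (1/n)·∑_{x ∈ S_good} q(x)². -/

import Mathlib

open scoped RealInnerProductSpace

theorem aux_shift {E : Type*} [NormedAddCommGroup E] [InnerProductSpace ℝ E]
    (S : Finset E) (v m c : E) (hm : ∑ x ∈ S, x = (S.card : ℝ) • m) :
    ∑ x ∈ S, ⟪v, x - c⟫ ^ 2 = ∑ x ∈ S, ⟪v, x - m⟫ ^ 2 + S.card * ⟪v, m - c⟫ ^ 2 := by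
  have h0 : ∑ x ∈ S, ⟪v, x - m⟫ = 0 := by
    rw [← inner_sum, Finset.sum_sub_distrib, hm, Finset.sum_const, Nat.cast_smul_eq_nsmul,
      sub_self, inner_zero_right]
  have h1 : ∀ x ∈ S, ⟪v, x - c⟫ ^ 2 =
      ⟪v, x - m⟫ ^ 2 + (2 * ⟪v, m - c⟫) * ⟪v, x - m⟫ + ⟪v, m - c⟫ ^ 2 := by
    intro x _
    have : x - c = (x - m) + (m - c) := by abel
    rw [this, inner_add_right]
    ring
  rw [Finset.sum_congr rfl h1, Finset.sum_add_distrib, Finset.sum_add_distrib,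
    ← Finset.mul_sum, h0, Finset.sum_const, nsmul_eq_mul]
  ring

/-- If `γ² > (K+1)²/(K-1)`, the average squared poisoning score of the bad
points is strictly larger than that of the clean points. -/
theorem bad_score_strictly_larger
    {E : Type*} [NormedAddCommGroup E] [InnerProductSpace ℝ E] [DecidableEq E]
    (Sgood Sbad : Finset E) (hdisj : Disjoint Sgood Sbad)
    (n np : ℕ) (hn : Sgood.card = n) (hnp : Sbad.card = np) (hnp0 : 0 < np)
    (K σ γ d : ℝ) (hK : 1 < K) (hσ : 0 < σ) (hγ : 0 ≤ γ)
    (hnK : (n : ℝ) = K * np)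
    (μg μp μs : E)
    (hμg : μg = (n : ℝ)⁻¹ • ∑ x ∈ Sgood, x)
    (hμp : μp = (np : ℝ)⁻¹ • ∑ x ∈ Sbad, x)
    (hμs : μs = (((Sgood ∪ Sbad).card : ℝ))⁻¹ • ∑ x ∈ Sgood ∪ Sbad, x)
    (hvar : ∀ v : E, ‖v‖ = 1 →
      (1 / (n : ℝ)) * ∑ x ∈ Sgood, ⟪v, x - μg⟫ ^ 2 ≤ σ ^ 2)
    (hd : d = γ * σ) (hdist : ‖μp - μg‖ = d)
    (hγ2 : γ ^ 2 > (K + 1) ^ 2 / (K - 1))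
    (V : E) (hV : ‖V‖ = 1)
    (hVtop : ∀ v : E, ‖v‖ = 1 →
      ∑ x ∈ Sgood ∪ Sbad, ⟪v, x - μs⟫ ^ 2 ≤
        ∑ x ∈ Sgood ∪ Sbad, ⟪V, x - μs⟫ ^ 2) :
    (1 / (np : ℝ)) * ∑ x ∈ Sbad, ⟪V, x - μs⟫ ^ 2 >
      (1 / (n : ℝ)) * ∑ x ∈ Sgood, ⟪V, x - μs⟫ ^ 2 := by
  have hp : (0:ℝ) < np := by exact_mod_cast hnp0
  have hK1 : 0 < K - 1 := by linarith
  have hK2 : 0 < K + 1 := by linarith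
  have hn0 : (0:ℝ) < n := by rw [hnK]; positivity
  have sg : ∑ x ∈ Sgood, x = (Sgood.card : ℝ) • μg := by
    rw [hμg, hn, smul_inv_smul₀ hn0.ne']
  have sb : ∑ x ∈ Sbad, x = (Sbad.card : ℝ) • μp := by
    rw [hμp, hnp, smul_inv_smul₀ hp.ne']
  have hμs' : (K + 1) • μs = K • μg + μp := by
    rw [hμs, Finset.card_union_of_disjoint hdisj, Finset.sum_union hdisj, sg, sb, hn, hnp]
    push_cast
    rw [hnK, smul_smul, smul_add, smul_smul, smul_smul]
    have e1 : (K + 1) * (K * np + np)⁻¹ * (K * np) = K := by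
      field_simp
    have e2 : (K + 1) * (K * np + np)⁻¹ * (np : ℝ) = 1 := by
      field_simp
    rw [e1, e2, one_smul]
  have hin : ∀ v : E, (K + 1) * ⟪v, μs⟫ = K * ⟪v, μg⟫ + ⟪v, μp⟫ := by
    intro v
    have := congrArg (fun z => ⟪v, z⟫) hμs'
    simpa only [inner_add_right, real_inner_smul_right] using this
  have g1 : ∀ v : E, ⟪v, μg - μs⟫ = -(⟪v, μp - μg⟫ / (K + 1)) := by
    intro v
    have := hin v
    rw [inner_sub_right, inner_sub_right]
    field_simp
    linarith
  have b1 : ∀ v : E, ⟪v, μp - μs⟫ = K * ⟪v, μp - μg⟫ / (K + 1) := by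
    intro v
    have := hin v
    rw [inner_sub_right, inner_sub_right]
    field_simp
    linarith
  have G : ∀ v : E, ∑ x ∈ Sgood, ⟪v, x - μs⟫ ^ 2 =
      ∑ x ∈ Sgood, ⟪v, x - μg⟫ ^ 2 + n * (⟪v, μp - μg⟫ / (K + 1)) ^ 2 := by
    intro v
    rw [aux_shift Sgood v μg μs sg, g1, hn, neg_sq]
  have B : ∀ v : E, ∑ x ∈ Sbad, ⟪v, x - μs⟫ ^ 2 =
      ∑ x ∈ Sbad, ⟪v, x - μp⟫ ^ 2 + np * (K * ⟪v, μp - μg⟫ / (K + 1)) ^ 2 := by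
    intro v
    rw [aux_shift Sbad v μp μs sb, b1, hnp]
  have hd2 : σ ^ 2 * (K + 1) ^ 2 < d ^ 2 * (K - 1) := by
    rw [gt_iff_lt, div_lt_iff₀ hK1] at hγ2
    have := mul_lt_mul_of_pos_left hγ2 (pow_pos hσ 2)
    rw [hd]
    linarith
  have hdpos : 0 < d := by
    have h0 : 0 ≤ d := hdist ▸ norm_nonneg _
    rcases h0.eq_or_lt with h | h
    · exfalso
      rw [← h] at hd2
      have : 0 < σ ^ 2 * (K + 1) ^ 2 := by positivity
      linarith
    · exact h
  have hu : ‖d⁻¹ • (μp - μg)‖ = 1 := by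
    rw [norm_smul, hdist, Real.norm_of_nonneg (by positivity), inv_mul_cancel₀ hdpos.ne']
  have hud : ⟪d⁻¹ • (μp - μg), μp - μg⟫ = d := by
    rw [real_inner_smul_left, real_inner_self_eq_norm_sq, hdist]
    field_simp
  have htop := hVtop _ hu
  rw [Finset.sum_union hdisj, Finset.sum_union hdisj, G, B, G, B, hud] at htop
  have hv := hvar V hV
  rw [G, B]
  have p1 : 0 ≤ ∑ x ∈ Sgood, ⟪d⁻¹ • (μp - μg), x - μg⟫ ^ 2 :=
    Finset.sum_nonneg fun _ _ => sq_nonneg _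
  have p2 : 0 ≤ ∑ x ∈ Sbad, ⟪d⁻¹ • (μp - μg), x - μp⟫ ^ 2 :=
    Finset.sum_nonneg fun _ _ => sq_nonneg _
  have p3 : 0 ≤ ∑ x ∈ Sbad, ⟪V, x - μp⟫ ^ 2 :=
    Finset.sum_nonneg fun _ _ => sq_nonneg _
  generalize (∑ x ∈ Sgood, ⟪d⁻¹ • (μp - μg), x - μg⟫ ^ 2) = A1 at *
  generalize (∑ x ∈ Sbad, ⟪d⁻¹ • (μp - μg), x - μp⟫ ^ 2) = A2 at *
  obtain ⟨b, hb⟩ : ∃ b, ∑ x ∈ Sbad, ⟪V, x - μp⟫ ^ 2 = np * b :=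
    ⟨(∑ x ∈ Sbad, ⟪V, x - μp⟫ ^ 2) / np, by field_simp⟩
  obtain ⟨g, hg⟩ : ∃ g, ∑ x ∈ Sgood, ⟪V, x - μg⟫ ^ 2 = n * g :=
    ⟨(∑ x ∈ Sgood, ⟪V, x - μg⟫ ^ 2) / n, by field_simp⟩
  rw [hb, hg] at htop
  rw [hb] at p3
  rw [hg] at hv
  rw [hb, hg]
  clear hb hg
  generalize ⟪V, μp - μg⟫ = t at *
  have hv' : g ≤ σ ^ 2 := by
    have : 1 / (n:ℝ) * (n * g) = g := by field_simp
    linarith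
  have hb0 : 0 ≤ b := le_of_mul_le_mul_left (by simpa using p3) hp
  -- the top direction inequality, divided by np
  have key : K * d ^ 2 ≤ (K + 1) * (K * g + b) + K * t ^ 2 := by
    have h1 : (n:ℝ) * (d / (K + 1)) ^ 2 + np * (K * d / (K + 1)) ^ 2 = np * (K * d ^ 2 / (K + 1)) := by
      rw [hnK]; field_simp; ring
    have h2 : (n:ℝ) * (t / (K + 1)) ^ 2 + np * (K * t / (K + 1)) ^ 2 = np * (K * t ^ 2 / (K + 1)) := by
      rw [hnK]; field_simp; ring
    have h3 : (np:ℝ) * (K * d ^ 2 / (K + 1)) ≤ np * (K * g + b + K * t ^ 2 / (K + 1)) := by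
      have : (n:ℝ) * g = np * (K * g) := by rw [hnK]; ring
      linarith
    have h4 := le_of_mul_le_mul_left h3 hp
    have h5 := mul_le_mul_of_nonneg_left h4 hK2.le
    have e1 : (K + 1) * (K * d ^ 2 / (K + 1)) = K * d ^ 2 := by field_simp
    have e2 : (K + 1) * (K * g + b + K * t ^ 2 / (K + 1)) = (K + 1) * (K * g + b) + K * t ^ 2 := by
      field_simp
    linarith
  have goal' : (K + 1) * g < (K + 1) * b + (K - 1) * t ^ 2 := by
    rcases lt_or_ge ((K + 1) * σ ^ 2) ((K - 1) * t ^ 2) with h | h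
    · nlinarith
    · have hs : 0 < σ ^ 2 := by positivity
      have q1 : (K + 1) * ((K + 1) * g) ≤ (K + 1) * ((K + 1) * σ ^ 2) := by gcongr
      have q2 : K * (σ ^ 2 * (K + 1) ^ 2) < K * (d ^ 2 * (K - 1)) := by gcongr
      have q3 := mul_le_mul_of_nonneg_left key hK1.le
      have q4 : (K - 1) * ((K + 1) * ((K + 1) * g)) ≤ (K - 1) * ((K + 1) * ((K + 1) * σ ^ 2)) := by
        gcongr
      have q5 : 0 < (K + 1) * K * σ ^ 2 := by positivity
      have : (K - 1) * ((K + 1) * g) < (K - 1) * ((K + 1) * b + (K - 1) * t ^ 2) := by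
        nlinarith
      exact lt_of_mul_lt_mul_left this hK1.le
  have f1 : 1 / (np:ℝ) * (np * b + np * (K * t / (K + 1)) ^ 2) = b + (K * t / (K + 1)) ^ 2 := by
    field_simp
  have f2 : 1 / (n:ℝ) * (n * g + n * (t / (K + 1)) ^ 2) = g + (t / (K + 1)) ^ 2 := by
    field_simp
  rw [f1, f2, gt_iff_lt, ← sub_pos]
  have f3 : b + (K * t / (K + 1)) ^ 2 - (g + (t / (K + 1)) ^ 2)
      = ((K + 1) * b + (K - 1) * t ^ 2 - (K + 1) * g) / (K + 1) := by
    field_simp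
    ring
  rw [f3]
  exact div_pos (by linarith) hK2
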